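/- Let n ≥ 1 and 𝐢 ∈ 𝐒_n, write π = p(𝐢) ∈ S_n, let 0 < r < n, and set (𝐣, q) = Φ(𝐢, r). Then q + 1 = min(π^{-1}(r), π^{-1}(r+1)), the value π(q+1) lies in {r, r+1}, and p(𝐣) ∈ S_{n−1} is obtained from π by removing the assignment q+1 ↦ π(q+1). -/

import Mathlib

/-- `𝐒_n = [n-1] × [n-2] × ⋯ × [0]`: the sequences `(i_1,…,i_n)` with `0 ≤ i_k ≤ n-k`. -/
abbrev SzIndex (n : ℕ) := ∀ k : Fin n, Fin (n - (k : ℕ))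

/-- The tail `(i_2,…,i_n)` of a sequence `(i_1,…,i_n) ∈ 𝐒_n`. -/
def szTail {n : ℕ} (i : SzIndex (n + 1)) : SzIndex n :=
  fun k => Fin.cast (Nat.succ_sub_succ n k) (i k.succ)

/-- The permutation of `Fin (n+1)` sending `0` to `v` and `j+1` to `e(j)`, where values
`≥ v` are shifted up by one (i.e. obtained from `e` by adding the assignment `0 ↦ v`). -/
def insertPerm {n : ℕ} (v : Fin (n + 1)) (e : Equiv.Perm (Fin n)) :
    Equiv.Perm (Fin (n + 1)) :=
  (finSuccEquiv n).trans ((Equiv.optionCongr e).trans (finSuccEquiv' v).symm)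

/-- The map `p : 𝐒_n → S_n`, defined recursively by `π(1) = i_1 + 1` and
`π(k) = π'(k-1)` resp. `π'(k-1) + 1` according to whether `π'(k-1) ≤ i_1`,
where `π' = p(i_2,…,i_n)` (here realized 0-based on `Fin n`). -/
def pMap : ∀ n : ℕ, SzIndex n → Equiv.Perm (Fin n)
  | 0, _ => 1
  | n + 1, i => insertPerm (i ⟨0, Nat.succ_pos n⟩) (pMap n (szTail i))

/-- `IsRemoval π i πt` says that `πt ∈ S_n` is obtained from `π ∈ S_{n+1}` by removing the
assignment `i ↦ π(i)` (everything 0-based): remaining entries are renumbered, preserving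
the mappings between them. -/
def IsRemoval {n : ℕ} (π : Equiv.Perm (Fin (n + 1))) (i : Fin (n + 1))
    (πt : Equiv.Perm (Fin n)) : Prop :=
  ∀ j : Fin n,
    (πt j : ℕ) =
      if (j : ℕ) < (i : ℕ) then
        (if (π j.castSucc : ℕ) < (π i : ℕ) then (π j.castSucc : ℕ) else (π j.castSucc : ℕ) - 1)
      else
        (if (π j.succ : ℕ) < (π i : ℕ) then (π j.succ : ℕ) else (π j.succ : ℕ) - 1)

/-- Prepending a value to a sequence in `𝐒_n` (the value is clamped into the valid range
`[0, n]`, which is irrelevant for the in-range uses below). -/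
def szCons {n : ℕ} (v : ℕ) (i : SzIndex n) : SzIndex (n + 1) := fun k =>
  match k with
  | ⟨0, _⟩ => ⟨min v n, by
      show min v n < n + 1 - 0
      have := Nat.min_le_right v n; omega⟩
  | ⟨t + 1, ht⟩ =>
    ⟨((i ⟨t, by omega⟩ : Fin (n - t)) : ℕ), by
      have h1 : ((i ⟨t, by omega⟩ : Fin (n - t)) : ℕ) < n - t := (i ⟨t, by omega⟩).isLt
      show ((i ⟨t, by omega⟩ : Fin (n - t)) : ℕ) < n + 1 - (t + 1)
      omega⟩

/-- The map `Φ : 𝐒_{n+1} × [n+1] → 𝐒_n × [n]`, defined recursively on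
`𝐢 = (i_1, 𝐢')`: if `r < i_1` then `Φ(𝐢, r) = ((i_1−1, 𝐣'), q'+1)` with
`(𝐣', q') = Φ(𝐢', r)`; if `r ∈ {i_1, i_1+1}` then `Φ(𝐢, r) = (𝐢', 0)`;
if `r > i_1+1` then `Φ(𝐢, r) = ((i_1, 𝐣'), q'+1)` with `(𝐣', q') = Φ(𝐢', r−1)`.
(The second argument and the `[n]`-component are given as natural numbers.) -/
def Phi : ∀ (n : ℕ), SzIndex (n + 1) → ℕ → SzIndex n × ℕ
  | 0, _, _ => (fun k => k.elim0, 0)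
  | n + 1, i, r =>
    let i1 : ℕ := (i ⟨0, Nat.succ_pos _⟩ : ℕ)
    if r < i1 then
      let p := Phi n (szTail i) r
      (szCons (i1 - 1) p.1, p.2 + 1)
    else if r ≤ i1 + 1 then (szTail i, 0)
    else
      let p := Phi n (szTail i) (r - 1)
      (szCons i1 p.1, p.2 + 1)

@[simp]
theorem insertPerm_zero {n : ℕ} (v : Fin (n + 1)) (e : Equiv.Perm (Fin n)) :
    insertPerm v e 0 = v := by
  simp [insertPerm]

@[simp]
theorem insertPerm_succ {n : ℕ} (v : Fin (n + 1)) (e : Equiv.Perm (Fin n)) (k : Fin n) :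
    insertPerm v e k.succ = v.succAbove (e k) := by
  simp [insertPerm]

theorem val_insertPerm_succ {n : ℕ} (v : Fin (n + 1)) (e : Equiv.Perm (Fin n)) (k : Fin n) :
    (insertPerm v e k.succ : ℕ) = if (e k : ℕ) < v then (e k : ℕ) else (e k : ℕ) + 1 := by
  rw [insertPerm_succ, Fin.succAbove]
  simp only [Fin.lt_def, Fin.val_castSucc]
  split_ifs <;> simp

theorem szTail_szCons {n : ℕ} (v : ℕ) (i : SzIndex n) : szTail (szCons v i) = i := by
  funext k
  rfl

theorem pMap_szCons {n : ℕ} (v : ℕ) (i : SzIndex n) (hv : v < n + 1) :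
    pMap (n + 1) (szCons v i) = insertPerm ⟨v, hv⟩ (pMap n i) := by
  rw [pMap, szTail_szCons]
  congr 1
  ext
  exact min_eq_left (Nat.lt_succ_iff.mp hv)

theorem IsRemoval.insertPerm {n : ℕ} {e : Equiv.Perm (Fin (n + 1))} {j : Fin (n + 1)}
    {e' : Equiv.Perm (Fin n)} (h : IsRemoval e j e') {v : Fin (n + 2)} {v' : Fin (n + 1)}
    (hv : (v' : ℕ) = if (e j : ℕ) < v then (v : ℕ) - 1 else v) :
    IsRemoval (insertPerm v e) j.succ (insertPerm v' e') := by
  intro k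
  induction k using Fin.cases with
  | zero =>
    rw [Fin.castSucc_zero, insertPerm_zero, insertPerm_zero, val_insertPerm_succ]
    simp only [Fin.val_zero, Fin.val_succ, Nat.succ_pos, if_true]
    by_cases hlt : (e j : ℕ) < v
    · simp only [hlt, if_true] at hv ⊢
      split_ifs <;> omega
    · simp only [hlt, if_false] at hv ⊢
      split_ifs <;> omega
  | succ k =>
    have hk := h k
    have h₁ : (k : ℕ) < j → (e k.castSucc : ℕ) ≠ e j := fun hlt heq => by
      have := congrArg Fin.val (e.injective (Fin.ext heq))
      simp only [Fin.val_castSucc] at this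
      omega
    have h₂ : ¬ (k : ℕ) < j → (e k.succ : ℕ) ≠ e j := fun hlt heq => by
      have := congrArg Fin.val (e.injective (Fin.ext heq))
      simp only [Fin.val_succ] at this
      omega
    rw [← Fin.succ_castSucc]
    simp only [val_insertPerm_succ, Fin.val_succ, Nat.add_lt_add_iff_right]
    by_cases hkj : (k : ℕ) < j
    · have := h₁ hkj
      simp only [hkj, if_true] at hk ⊢
      split_ifs at hv hk ⊢ <;> omega
    · have := h₂ hkj
      simp only [hkj, if_false] at hk ⊢
      split_ifs at hv hk ⊢ <;> omega

theorem insertPerm_isRemoval_zero {n : ℕ} (v : Fin (n + 1)) (e : Equiv.Perm (Fin n)) :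
    IsRemoval (insertPerm v e) 0 e := by
  intro k
  rw [insertPerm_zero, val_insertPerm_succ]
  simp only [Fin.val_zero, Nat.not_lt_zero, if_false]
  split_ifs <;> omega

/-- The first position at which `p(𝐢)` takes one of the (0-based) values `r - 1` and `r` is
the second component of `Φ(𝐢, r)`, and removing it gives `p` of the first component. -/
theorem exists_first_position_Phi (n : ℕ) (i : SzIndex (n + 1)) (r : ℕ) (hr0 : 0 < r)
    (hrn : r < n + 1) :
    ∃ j : Fin (n + 1), (Phi n i r).2 = (j : ℕ) ∧
      ((pMap (n + 1) i j : ℕ) = r - 1 ∨ (pMap (n + 1) i j : ℕ) = r) ∧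
      (∀ k, (pMap (n + 1) i k : ℕ) = r - 1 ∨ (pMap (n + 1) i k : ℕ) = r → j ≤ k) ∧
      IsRemoval (pMap (n + 1) i) j (pMap n (Phi n i r).1) := by
  induction n generalizing r with
  | zero => omega
  | succ n ih =>
    rw [pMap, Phi]
    generalize i ⟨0, Nat.succ_pos _⟩ = v
    change Fin (n + 2) at v
    have hvn := v.isLt
    dsimp only
    split_ifs with h₁ h₂
    · obtain ⟨j, hq, hj, hmin, hrem⟩ := ih (szTail i) r hr0 (by omega)
      refine ⟨j.succ, by simp [hq], ?_, ?_, ?_⟩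
      · rw [val_insertPerm_succ]
        split_ifs <;> omega
      · intro k hk
        induction k using Fin.cases with
        | zero =>
          rw [insertPerm_zero] at hk
          omega
        | succ k =>
          rw [val_insertPerm_succ] at hk
          refine Fin.succ_le_succ_iff.mpr (hmin k ?_)
          split_ifs at hk <;> omega
      · rw [pMap_szCons _ _ (by omega)]
        refine hrem.insertPerm ?_
        dsimp only
        split_ifs <;> omega
    · refine ⟨0, rfl, ?_, fun k _ => Fin.zero_le k, insertPerm_isRemoval_zero v _⟩
      rw [insertPerm_zero]
      omega
    · obtain ⟨j, hq, hj, hmin, hrem⟩ := ih (szTail i) (r - 1) (by omega) (by omega)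
      refine ⟨j.succ, by simp [hq], ?_, ?_, ?_⟩
      · rw [val_insertPerm_succ]
        split_ifs <;> omega
      · intro k hk
        induction k using Fin.cases with
        | zero =>
          rw [insertPerm_zero] at hk
          omega
        | succ k =>
          rw [val_insertPerm_succ] at hk
          refine Fin.succ_le_succ_iff.mpr (hmin k ?_)
          split_ifs at hk <;> omega
      · rw [pMap_szCons _ _ (by omega)]
        refine hrem.insertPerm ?_
        dsimp only
        split_ifs <;> omega


/-- Let `n+1 ≥ 1`, `𝐢 ∈ 𝐒_{n+1}`, `π = p(𝐢) ∈ S_{n+1}`, let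
`0 < r < n+1`, and set `(𝐣, q) = Φ(𝐢, r)`.  Then `q + 1 = min(π⁻¹(r), π⁻¹(r+1))`
(0-based: `q` is the position `j = min(π⁻¹(r-1), π⁻¹(r))`), the value `π(q+1)` lies in
`{r, r+1}` (0-based: `π(j) ∈ {r-1, r}`), and `p(𝐣) ∈ S_n` is obtained from `π` by
removing the assignment `q+1 ↦ π(q+1)`. -/
theorem szczarba_stmt18 (n : ℕ) (i : SzIndex (n + 1)) (r : ℕ) (hr0 : 0 < r)
    (hrn : r < n + 1)
    (π : Equiv.Perm (Fin (n + 1))) (hπ : π = pMap (n + 1) i)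
    (j : Fin (n + 1))
    (hj : j = min (π.symm ⟨r - 1, by omega⟩) (π.symm ⟨r, by omega⟩)) :
    (Phi n i r).2 = (j : ℕ) ∧
    ((π j : ℕ) = r - 1 ∨ (π j : ℕ) = r) ∧
    IsRemoval π j (pMap n (Phi n i r).1) := by
  subst hπ
  obtain ⟨j', hq, hj', hmin, hrem⟩ := exists_first_position_Phi n i r hr0 hrn
  have hjj : j = j' := by
    rw [hj]
    refine le_antisymm ?_ (le_min (hmin _ (by simp)) (hmin _ (by simp)))
    rcases hj' with h | h
    · exact min_le_of_left_le (((Equiv.symm_apply_eq _).mpr (Fin.ext h.symm)).le)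
    · exact min_le_of_right_le (((Equiv.symm_apply_eq _).mpr (Fin.ext h.symm)).le)
  rw [hjj]
  exact ⟨hq, hj', hrem⟩
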